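/- Fix an integer ℓ ≥ 1 and an alphabet A_q with q ≥ 2. For any a, b ∈ A_q^n with support set S = {i : a_i ≠ b_i} and any single letters a', b' ∈ A_q, the Non-Homopolymer distance of the extended strings satisfies: d_NHo((a, a'), (b, b')) = d_NHo(a, b) if a' = b' and |S| is even; d_NHo((a, a'), (b, b')) = ℓ + d_NHo(a, b) if a' = b' and |S| is odd; d_NHo((a, a'), (b, b')) = ℓ + d_NHo(a, b) if a' ≠ b' and |S| is even; and d_NHo((a, a'), (b, b')) = d_NHo(a, b) if a' ≠ b' and |S| is odd. -/

import Mathlib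

/-- Sum of the gaps t₂ − t₁, t₄ − t₃, … over consecutive pairs of a list. -/
def pairSum : List ℕ → ℕ
  | [] => 0
  | [_] => 0
  | a :: b :: rest => (b - a) + pairSum rest

/-- The support set S = {i : a_i ≠ b_i} of two strings, with 1-based positions. -/
def supportSet {A : Type*} [DecidableEq A] {n : ℕ} (a b : Fin n → A) : Finset ℕ :=
  (Finset.univ.filter (fun i : Fin n => a i ≠ b i)).image (fun i => i.val + 1)

/-- The extended support set T: S together with n+1 when |S| is odd. -/
def extSupport {A : Type*} [DecidableEq A] {n : ℕ} (a b : Fin n → A) : Finset ℕ :=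
  if Odd (supportSet a b).card then insert (n + 1) (supportSet a b) else supportSet a b

/-- The Non-Homopolymer distance d_NHo(a,b) = ℓ · Σ_j (t_{2j} − t_{2j−1}), where
t_1 < t_2 < … enumerate the extended support set (and 0 when it is empty). -/
def dNHo {A : Type*} [DecidableEq A] (ℓ : ℕ) {n : ℕ} (a b : Fin n → A) : ℕ :=
  ℓ * pairSum ((extSupport a b).sort (· ≤ ·))

theorem pairSum_odd (m : ℕ) : ∀ L : List ℕ, Odd L.length → (∀ x ∈ L, x ≤ m) →
    pairSum (L ++ [m + 1]) = 1 + pairSum (L ++ [m])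
  | [], h, _ => by simp at h
  | [x], _, h => by
      have := h x (by simp)
      simp [pairSum]; omega
  | x :: y :: r, h, hm => by
      have := pairSum_odd m r (by simp at h; grind) (fun z hz => hm z (by simp [hz]))
      simp only [List.cons_append, pairSum, this]; omega

theorem pairSum_even (m : ℕ) : ∀ L : List ℕ, Even L.length →
    pairSum (L ++ [m, m + 1]) = 1 + pairSum L
  | [], _ => by simp [pairSum]
  | [x], h => by simp at h
  | x :: y :: r, h => by
      have := pairSum_even m r (by simp at h; grind)
      simp only [List.cons_append, pairSum, this]; omega

theorem sort_insert_top (S : Finset ℕ) (m : ℕ) (h : ∀ x ∈ S, x < m) :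
    (insert m S).sort (· ≤ ·) = S.sort (· ≤ ·) ++ [m] := by
  have hm : m ∉ S := fun hh => lt_irrefl _ (h m hh)
  refine List.Perm.eq_of_pairwise' (r := (· ≤ ·)) (Finset.pairwise_sort _ _) ?_ ?_
  · rw [List.pairwise_append]
    refine ⟨Finset.pairwise_sort _ _, by simp, ?_⟩
    intro x hx y hy
    simp at hx hy
    subst hy
    exact (h x hx).le
  · rw [List.perm_ext_iff_of_nodup (Finset.sort_nodup _ _)]
    · intro x; simp [or_comm]
    · rw [List.nodup_append]
      refine ⟨Finset.sort_nodup _ _, by simp, ?_⟩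
      intro x hx y hy
      simp at hx hy
      subst hy
      exact (h x hx).ne

theorem supportSet_le {A : Type*} [DecidableEq A] {n : ℕ} (a b : Fin n → A) :
    ∀ x ∈ supportSet a b, x ≤ n := by
  intro x hx
  simp only [supportSet, Finset.mem_image] at hx
  obtain ⟨i, _, rfl⟩ := hx
  omega

theorem supportSet_snoc {A : Type*} [DecidableEq A] {n : ℕ} (a b : Fin n → A) (a' b' : A) :
    supportSet (Fin.snoc a a' : Fin (n + 1) → A) (Fin.snoc b b') =
      if a' = b' then supportSet a b else insert (n + 1) (supportSet a b) := by
  have key : ∀ P : Fin (n + 1) → Prop,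
      (∃ i, P i) ↔ (∃ i : Fin n, P i.castSucc) ∨ P (Fin.last n) := by
    intro P
    constructor
    · rintro ⟨i, hi⟩
      induction i using Fin.lastCases with
      | last => exact Or.inr hi
      | cast i => exact Or.inl ⟨i, hi⟩
    · rintro (⟨i, hi⟩ | hi)
      · exact ⟨_, hi⟩
      · exact ⟨_, hi⟩
  ext x
  split_ifs with h <;>
    simp only [supportSet, Finset.mem_insert, Finset.mem_image, Finset.mem_filter,
      Finset.mem_univ, true_and, key, Fin.snoc_castSucc, Fin.snoc_last, Fin.val_castSucc,
      Fin.val_last, h] <;> grind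

/-- recurrence for the Non-Homopolymer distance upon appending one
letter to each string, according to whether the appended letters agree and to the
parity of the size of the support set S = {i : a_i ≠ b_i}. -/
theorem stmt15 {A : Type*} [Fintype A] [DecidableEq A] (hq : 2 ≤ Fintype.card A)
    {ℓ : ℕ} (hℓ : 1 ≤ ℓ) {n : ℕ} (a b : Fin n → A) (a' b' : A) :
    (a' = b' → Even (supportSet a b).card →
      dNHo ℓ (Fin.snoc a a') (Fin.snoc b b') = dNHo ℓ a b) ∧
    (a' = b' → Odd (supportSet a b).card →
      dNHo ℓ (Fin.snoc a a') (Fin.snoc b b') = ℓ + dNHo ℓ a b) ∧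
    (a' ≠ b' → Even (supportSet a b).card →
      dNHo ℓ (Fin.snoc a a') (Fin.snoc b b') = ℓ + dNHo ℓ a b) ∧
    (a' ≠ b' → Odd (supportSet a b).card →
      dNHo ℓ (Fin.snoc a a') (Fin.snoc b b') = dNHo ℓ a b) := by
  have hle := supportSet_le a b
  have hlt : ∀ x ∈ supportSet a b, x < n + 1 := fun x hx => by have := hle x hx; omega
  have hlt2 : ∀ x ∈ supportSet a b, x < n + 1 + 1 := fun x hx => by have := hle x hx; omega
  have hlt3 : ∀ x ∈ insert (n + 1) (supportSet a b), x < n + 1 + 1 := by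
    intro x hx
    rcases Finset.mem_insert.1 hx with rfl | hx
    · omega
    · exact hlt2 x hx
  have hn : n + 1 ∉ supportSet a b := fun h => lt_irrefl _ (hlt _ h)
  have hc : (insert (n + 1) (supportSet a b)).card = (supportSet a b).card + 1 :=
    Finset.card_insert_of_notMem hn
  refine ⟨fun h hS => ?_, fun h hS => ?_, fun h hS => ?_, fun h hS => ?_⟩
  · have h1 : ¬ Odd (supportSet a b).card := by simpa using hS
    simp only [dNHo, extSupport, supportSet_snoc, if_pos h, if_neg h1]
  · simp only [dNHo, extSupport, supportSet_snoc, if_pos h, if_pos hS]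
    rw [sort_insert_top _ _ hlt, sort_insert_top _ _ hlt2, pairSum_odd]
    · ring
    · simpa using hS
    · intro x hx
      exact (hlt x (by simpa using hx)).le
  · have h1 : ¬ Odd (supportSet a b).card := by simpa using hS
    have h2 : Odd (insert (n + 1) (supportSet a b)).card := by rw [hc]; exact hS.add_one
    simp only [dNHo, extSupport, supportSet_snoc, if_neg h, if_pos h2, if_neg h1]
    rw [sort_insert_top _ _ hlt3, sort_insert_top _ _ hlt, List.append_assoc]
    have := pairSum_even (n + 1) ((supportSet a b).sort (· ≤ ·)) (by simpa using hS)
    simp only [List.singleton_append]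
    rw [this]; ring
  · have h2 : ¬ Odd (insert (n + 1) (supportSet a b)).card := by
      rw [hc]; simpa using hS.add_one
    simp only [dNHo, extSupport, supportSet_snoc, if_neg h, if_neg h2, if_pos hS]
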